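/- arXiv:2105.12937 — 5 statements merged into one kernel-verified Lean document; each statement's English description precedes it below -/
import Mathlib

section
/- Let X be a real m×n matrix and Γ a real n×n matrix with XᵀX + ΓᵀΓ invertible, let X̄ be the (m+n)×n matrix obtained by stacking X on top of Γ, and let W* = (XᵀX + ΓᵀΓ)⁻¹XᵀX. Let X̄W* = PΣ'Qᵀ be a singular value decomposition with singular values in non-increasing order, and for 1 ≤ k ≤ n let Q_k denote the first k columns of Q. Then Ŵ = W*(Q_k Q_kᵀ) = (XᵀX + ΓᵀΓ)⁻¹XᵀX(Q_k Q_kᵀ) minimizes the objective ‖X − XW‖_F² + ‖ΓW‖_F² over all real n×n matrices W with rank(W) ≤ k. -/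
open Matrix BigOperators

noncomputable def frobSq {m n : Type*} [Fintype m] [Fintype n] (A : Matrix m n ℝ) : ℝ :=
  ∑ i, ∑ j, (A i j) ^ 2

theorem frobSq_eq_trace {m n : Type*} [Fintype m] [Fintype n] (A : Matrix m n ℝ) :
    frobSq A = (Aᵀ * A).trace := by
  simp only [frobSq, Matrix.trace, Matrix.diag, Matrix.mul_apply, Matrix.transpose_apply]
  rw [Finset.sum_comm]
  simp [sq]

theorem frobSq_orth_left {m n l : Type*} [Fintype m] [Fintype n] [Fintype l] [DecidableEq n]
    (P : Matrix m n ℝ) (hP : Pᵀ * P = 1) (M : Matrix n l ℝ) : frobSq (P * M) = frobSq M := by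
  rw [frobSq_eq_trace, frobSq_eq_trace, Matrix.transpose_mul, Matrix.mul_assoc,
    ← Matrix.mul_assoc Pᵀ, hP, Matrix.one_mul]

theorem frobSq_orth_right {m n : Type*} [Fintype m] [Fintype n] [DecidableEq n]
    (U : Matrix n n ℝ) (hU : Uᵀ * U = 1) (M : Matrix m n ℝ) : frobSq (M * U) = frobSq M := by
  have hU' : U * Uᵀ = 1 := mul_eq_one_comm.mp hU
  rw [frobSq_eq_trace, frobSq_eq_trace, Matrix.transpose_mul, Matrix.mul_assoc,
    Matrix.trace_mul_comm, Matrix.mul_assoc, Matrix.mul_assoc, hU', Matrix.mul_one]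

theorem exists_orth_kill {n : ℕ} (W : Matrix (Fin n) (Fin n) ℝ) :
    ∃ (U : Matrix (Fin n) (Fin n) ℝ) (S : Finset (Fin n)), Uᵀ * U = 1 ∧ S.card = W.rank ∧
      ∀ j ∉ S, ∀ i, (W * U) i j = 0 := by
  classical
  have hH : (Wᵀ * W).IsHermitian := by
    have := Matrix.isHermitian_conjTranspose_mul_self W
    rwa [Matrix.conjTranspose_eq_transpose_of_trivial] at this
  let U : Matrix (Fin n) (Fin n) ℝ := hH.eigenvectorUnitary
  have hU : Uᵀ * U = 1 := by
    have := Unitary.coe_star_mul_self hH.eigenvectorUnitary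
    rwa [Matrix.star_eq_conjTranspose, Matrix.conjTranspose_eq_transpose_of_trivial] at this
  refine ⟨U, Finset.univ.filter (fun j => hH.eigenvalues j ≠ 0), hU, ?_, ?_⟩
  · rw [← Matrix.rank_transpose_mul_self W, hH.rank_eq_card_non_zero_eigs, Fintype.card_subtype]
  · intro j hj
    have hj' : hH.eigenvalues j = 0 := by simpa using hj
    have h1 : (Wᵀ * W) *ᵥ (U.col j) = 0 := by
      have := hH.mulVec_eigenvectorBasis j
      rw [hj', zero_smul] at this
      convert this using 2
      exact hH.eigenvectorUnitary_col_eq j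
    have h2 : W *ᵥ (U.col j) = 0 := by
      have := Matrix.conjTranspose_mul_self_mulVec_eq_zero W (U.col j)
      rw [Matrix.conjTranspose_eq_transpose_of_trivial] at this
      exact this.mp h1
    intro i
    exact congrFun h2 i

theorem eckart_young_lower {m : Type*} [Fintype m] {n : ℕ}
    (P : Matrix m (Fin n) ℝ) (Q : Matrix (Fin n) (Fin n) ℝ) (s : Fin n → ℝ)
    (hP : Pᵀ * P = 1) (hQ : Qᵀ * Q = 1) (hs : ∀ i, 0 ≤ s i)
    (hord : ∀ i j : Fin n, i ≤ j → s j ≤ s i) (Y : Matrix m (Fin n) ℝ)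
    (W : Matrix (Fin n) (Fin n) ℝ) (k : ℕ) (hk1 : 1 ≤ k) (hk : k ≤ n) (hW : W.rank ≤ k) :
    ∑ i : Fin n, (if (i : ℕ) < k then 0 else s i ^ 2) ≤
      frobSq (P * Matrix.diagonal s * Qᵀ - Y * W) := by
  obtain ⟨U, S, hU, hS, hker⟩ := exists_orth_kill W
  set Z := Qᵀ * U with hZ
  have hQ' : Q * Qᵀ = 1 := mul_eq_one_comm.mp hQ
  have hZ1 : Zᵀ * Z = 1 := by
    rw [hZ, Matrix.transpose_mul, Matrix.transpose_transpose, Matrix.mul_assoc,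
      ← Matrix.mul_assoc Q, hQ', Matrix.one_mul, hU]
  have hZ2 : Z * Zᵀ = 1 := mul_eq_one_comm.mp hZ1
  have hcol : ∀ j, ∑ i, Z i j ^ 2 = 1 := by
    intro j
    have := congrFun (congrFun hZ1 j) j
    simpa [Matrix.mul_apply, sq] using this
  have hrow : ∀ i, ∑ j, Z i j ^ 2 = 1 := by
    intro i
    have := congrFun (congrFun hZ2 i) i
    simpa [Matrix.mul_apply, sq] using this
  set D := P * Matrix.diagonal s * Qᵀ - Y * W with hD
  have hDU : ∀ j ∉ S, ∀ i, (D * U) i j = (P * (Matrix.diagonal s * Z)) i j := by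
    intro j hj i
    have : D * U = P * (Matrix.diagonal s * Z) - Y * (W * U) := by
      rw [hD, hZ, Matrix.sub_mul]; simp only [Matrix.mul_assoc]
    rw [this, Matrix.sub_apply, Matrix.mul_apply (M := Y)]
    simp [hker j hj]
  have hcolP : ∀ j, ∑ i, (P * (Matrix.diagonal s * Z)) i j ^ 2 = ∑ i, s i ^ 2 * Z i j ^ 2 := by
    intro j
    have h : (P * (Matrix.diagonal s * Z))ᵀ * (P * (Matrix.diagonal s * Z)) =
        (Matrix.diagonal s * Z)ᵀ * (Matrix.diagonal s * Z) := by
      rw [Matrix.transpose_mul, Matrix.mul_assoc, ← Matrix.mul_assoc Pᵀ, hP, Matrix.one_mul]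
    have := congrFun (congrFun h j) j
    rw [Matrix.mul_apply, Matrix.mul_apply] at this
    simp only [Matrix.transpose_apply, ← sq] at this
    rw [this]
    simp [Matrix.diagonal_mul, mul_pow]
  set t : Fin n → ℝ := fun i => ∑ j ∈ Sᶜ, Z i j ^ 2 with ht
  have ht0 : ∀ i, 0 ≤ t i := fun i => Finset.sum_nonneg fun j _ => sq_nonneg _
  have ht1 : ∀ i, t i ≤ 1 := fun i => by
    rw [← hrow i]
    exact Finset.sum_le_sum_of_subset_of_nonneg (Finset.subset_univ _) fun j _ _ => sq_nonneg _
  have htsum : (n : ℝ) - k ≤ ∑ i, t i := by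
    rw [ht, Finset.sum_comm]
    simp only [hcol, Finset.sum_const, nsmul_eq_mul, mul_one]
    have h1 := Finset.card_add_card_compl S
    rw [Fintype.card_fin] at h1
    have h2 : (S.card : ℝ) + (Sᶜ.card : ℝ) = n := by exact_mod_cast h1
    have h3 : (S.card : ℝ) ≤ k := by exact_mod_cast hS ▸ hW
    linarith
  have hlow : ∑ i, s i ^ 2 * t i ≤ frobSq D := by
    rw [← frobSq_orth_right U hU D, frobSq, Finset.sum_comm]
    calc ∑ i, s i ^ 2 * t i = ∑ j ∈ Sᶜ, ∑ i, s i ^ 2 * Z i j ^ 2 := by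
          rw [Finset.sum_comm]; simp [ht, Finset.mul_sum]
      _ = ∑ j ∈ Sᶜ, ∑ i, (D * U) i j ^ 2 := by
          refine Finset.sum_congr rfl fun j hj => ?_
          rw [← hcolP]
          refine Finset.sum_congr rfl fun i _ => ?_
          rw [hDU j (by simpa using hj)]
      _ ≤ _ := Finset.sum_le_sum_of_subset_of_nonneg (Finset.subset_univ _)
          fun j _ _ => Finset.sum_nonneg fun i _ => sq_nonneg _
  refine le_trans ?_ hlow
  let p : Fin n := ⟨k - 1, by omega⟩
  have hcount : ∑ i : Fin n, (if (i : ℕ) < k then (0 : ℝ) else 1) = n - k := by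
    have h : ∑ i : Fin n, (if (i : ℕ) < k then (1 : ℝ) else 0) = k := by
      rw [Fin.sum_univ_eq_sum_range (fun i => if i < k then (1 : ℝ) else 0) n,
        ← Finset.sum_filter]
      have : (Finset.range n).filter (fun i => i < k) = Finset.range k := by
        ext i; simp; omega
      simp [this]
    have h' : ∑ i : Fin n, ((if (i : ℕ) < k then (0 : ℝ) else 1) +
        (if (i : ℕ) < k then (1 : ℝ) else 0)) = n := by
      rw [Finset.sum_congr rfl (g := fun _ => (1 : ℝ))]
      · simp
      · intro i _; split_ifs <;> simp
    rw [Finset.sum_add_distrib, h] at h'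
    linarith
  have key : ∑ i : Fin n, ((if (i : ℕ) < k then 0 else s i ^ 2) +
      s p ^ 2 * (t i - (if (i : ℕ) < k then (0 : ℝ) else 1))) ≤ ∑ i, s i ^ 2 * t i := by
    refine Finset.sum_le_sum fun i _ => ?_
    split_ifs with hi
    · have h1 : s p ≤ s i := hord i p (Fin.le_def.mpr (by simp [p]; omega))
      have h2 : s p ^ 2 ≤ s i ^ 2 := pow_le_pow_left₀ (hs p) h1 2
      nlinarith [mul_le_mul_of_nonneg_right h2 (ht0 i)]
    · have h1 : s i ≤ s p := hord p i (Fin.le_def.mpr (by simp [p]; omega))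
      have h2 : s i ^ 2 ≤ s p ^ 2 := pow_le_pow_left₀ (hs i) h1 2
      nlinarith [mul_nonneg (sub_nonneg.mpr h2) (sub_nonneg.mpr (ht1 i))]
  rw [Finset.sum_add_distrib, ← Finset.mul_sum, Finset.sum_sub_distrib, hcount] at key
  nlinarith [mul_nonneg (sq_nonneg (s p)) (sub_nonneg.mpr htsum)]

theorem Qk_eq {n k : ℕ} (hk : k ≤ n) (Q : Matrix (Fin n) (Fin n) ℝ) :
    Q.submatrix id (Fin.castLE hk) * (Q.submatrix id (Fin.castLE hk))ᵀ =
      Q * Matrix.diagonal (fun i : Fin n => if (i : ℕ) < k then (1 : ℝ) else 0) * Qᵀ := by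
  obtain ⟨d, rfl⟩ := Nat.exists_eq_add_of_le hk
  ext a b
  rw [Matrix.mul_apply, Matrix.mul_apply, Fin.sum_univ_add]
  simp only [Matrix.mul_diagonal]
  simp
  rfl

theorem eckart_young_upper {m : Type*} [Fintype m] {n k : ℕ} (hk : k ≤ n)
    (P : Matrix m (Fin n) ℝ) (Q : Matrix (Fin n) (Fin n) ℝ) (s : Fin n → ℝ)
    (hP : Pᵀ * P = 1) (hQ : Qᵀ * Q = 1) :
    frobSq (P * Matrix.diagonal s * Qᵀ - P * Matrix.diagonal s * Qᵀ *
      (Q.submatrix id (Fin.castLE hk) * (Q.submatrix id (Fin.castLE hk))ᵀ)) =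
    ∑ i : Fin n, (if (i : ℕ) < k then 0 else s i ^ 2) := by
  rw [Qk_eq, ← frobSq_orth_right Q hQ]
  have : (P * Matrix.diagonal s * Qᵀ - P * Matrix.diagonal s * Qᵀ *
      (Q * Matrix.diagonal (fun i : Fin n => if (i : ℕ) < k then (1 : ℝ) else 0) * Qᵀ)) * Q =
      P * Matrix.diagonal (fun i : Fin n => if (i : ℕ) < k then (0 : ℝ) else s i) := by
    calc _ = P * Matrix.diagonal s * (Qᵀ * Q) - P * Matrix.diagonal s * (Qᵀ * Q) *
          Matrix.diagonal (fun i : Fin n => if (i : ℕ) < k then (1 : ℝ) else 0) * (Qᵀ * Q) := by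
          simp only [Matrix.sub_mul, Matrix.mul_assoc]
      _ = _ := by
          rw [hQ]
          simp only [Matrix.mul_one, Matrix.mul_assoc, ← Matrix.mul_sub,
            Matrix.diagonal_mul_diagonal, Matrix.diagonal_sub]
          congr 2
          ext i
          split_ifs <;> simp
  rw [this, frobSq_orth_left P hP, frobSq]
  refine Finset.sum_congr rfl fun i _ => ?_
  rw [Finset.sum_eq_single i]
  · simp
  · intro j _ hj; rw [Matrix.diagonal_apply_ne' _ hj]; simp
  · simp

theorem objective_eq {m n : ℕ} (X : Matrix (Fin m) (Fin n) ℝ) (Γ Ws W : Matrix (Fin n) (Fin n) ℝ)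
    (hW : (Xᵀ * X + Γᵀ * Γ) * Ws = Xᵀ * X) :
    frobSq (X - X * W) + frobSq (Γ * W) =
      frobSq X - frobSq (Matrix.fromRows X Γ * Ws) +
        frobSq (Matrix.fromRows X Γ * Ws - Matrix.fromRows X Γ * W) := by
  have hG : (Matrix.fromRows X Γ)ᵀ * Matrix.fromRows X Γ = Xᵀ * X + Γᵀ * Γ := by
    rw [Matrix.transpose_fromRows, Matrix.fromCols_mul_fromRows]
  set B := Matrix.fromRows X Γ
  have e1 : Bᵀ * (B * Ws) = Xᵀ * X := by rw [← Matrix.mul_assoc, hG, hW]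
  have e2 : (B * Ws)ᵀ * B = Xᵀ * X := by
    have := congrArg Matrix.transpose e1
    simpa [Matrix.transpose_mul] using this
  simp only [frobSq_eq_trace]
  have h1 : (X - X * W)ᵀ * (X - X * W) + (Γ * W)ᵀ * (Γ * W) =
      Xᵀ * X - Xᵀ * X * W - Wᵀ * (Xᵀ * X) + Wᵀ * ((Xᵀ * X + Γᵀ * Γ) * W) := by
    simp only [Matrix.transpose_sub, Matrix.transpose_mul, Matrix.sub_mul, Matrix.mul_sub,
      Matrix.add_mul, Matrix.mul_add, Matrix.mul_assoc]
    abel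
  have h2 : (B * Ws - B * W)ᵀ * (B * Ws - B * W) =
      (B * Ws)ᵀ * (B * Ws) - Xᵀ * X * W - Wᵀ * (Xᵀ * X) + Wᵀ * ((Xᵀ * X + Γᵀ * Γ) * W) := by
    rw [Matrix.transpose_sub, Matrix.sub_mul, Matrix.mul_sub, Matrix.mul_sub,
      Matrix.transpose_mul B W, ← Matrix.mul_assoc (B * Ws)ᵀ B W, e2, Matrix.mul_assoc Wᵀ, e1,
      Matrix.mul_assoc Wᵀ, ← Matrix.mul_assoc Bᵀ B W, hG]
    abel
  rw [← Matrix.trace_add, h1, h2]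
  simp only [Matrix.trace_add, Matrix.trace_sub]
  ring

theorem stmt_4 {m n : ℕ} (X : Matrix (Fin m) (Fin n) ℝ) (Γ : Matrix (Fin n) (Fin n) ℝ)
    (hinv : IsUnit (Xᵀ * X + Γᵀ * Γ))
    (Wstar : Matrix (Fin n) (Fin n) ℝ)
    (hWstar : Wstar = (Xᵀ * X + Γᵀ * Γ)⁻¹ * (Xᵀ * X))
    (Xbar : Matrix (Fin m ⊕ Fin n) (Fin n) ℝ) (hXbar : Xbar = Matrix.fromRows X Γ)
    (P : Matrix (Fin m ⊕ Fin n) (Fin n) ℝ) (Q : Matrix (Fin n) (Fin n) ℝ) (σ' : Fin n → ℝ)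
    (hP : Pᵀ * P = 1) (hQ : Qᵀ * Q = 1)
    (hσnn : ∀ i, 0 ≤ σ' i)
    (hσord : ∀ i j : Fin n, i ≤ j → σ' j ≤ σ' i)
    (hSVD : Xbar * Wstar = P * Matrix.diagonal σ' * Qᵀ)
    (k : ℕ) (hk1 : 1 ≤ k) (hk : k ≤ n) :
    let Qk : Matrix (Fin n) (Fin k) ℝ := Q.submatrix id (Fin.castLE hk)
    let What : Matrix (Fin n) (Fin n) ℝ := Wstar * (Qk * Qkᵀ)
    What.rank ≤ k ∧
    ∀ W : Matrix (Fin n) (Fin n) ℝ, W.rank ≤ k →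
      frobSq (X - X * What) + frobSq (Γ * What) ≤ frobSq (X - X * W) + frobSq (Γ * W) := by
  intro Qk What
  refine ⟨?_, ?_⟩
  · calc What.rank ≤ (Qk * Qkᵀ).rank := Matrix.rank_mul_le_right _ _
      _ ≤ Qk.rank := Matrix.rank_mul_le_left _ _
      _ ≤ k := by simpa using Matrix.rank_le_width Qk
  · intro W hW
    have hG : (Xᵀ * X + Γᵀ * Γ) * Wstar = Xᵀ * X := by
      rw [hWstar, ← Matrix.mul_assoc,
        Matrix.mul_nonsing_inv _ ((Matrix.isUnit_iff_isUnit_det _).mp hinv), Matrix.one_mul]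
    rw [objective_eq X Γ Wstar What hG, objective_eq X Γ Wstar W hG, ← hXbar]
    have h1 := eckart_young_lower P Q σ' hP hQ hσnn hσord Xbar W k hk1 hk hW
    have h2 := eckart_young_upper hk P Q σ' hP hQ
    rw [← hSVD] at h1 h2
    have h3 : Xbar * What = Xbar * Wstar * (Qk * Qkᵀ) := by
      simp only [What, Matrix.mul_assoc]
    rw [h3, h2]
    linarith
end

section
/- Let X be a real m×n matrix (m ≥ n) with singular value decomposition X = UΣVᵀ, where U is m×n with orthonormal columns (UᵀU = I_n), V is n×n orthogonal, and Σ = diag(σ₁,…,σ_n) with σ₁ ≥ … ≥ σ_n ≥ 0. Let Λ = diag(λ₁,…,λ_n) with λ_i ≥ 0 and σ_i² + λ_i > 0, let Γ be an n×n matrix with ΓᵀΓ = VΛVᵀ, let X̄ be the (m+n)×n matrix stacking X on top of Γ, and let W* = (XᵀX + ΓᵀΓ)⁻¹XᵀX. Then the Gram matrix of the fitted values satisfies (X̄W*)ᵀ(X̄W*) = V · diag(σ₁⁴/(σ₁²+λ₁), …, σ_n⁴/(σ_n²+λ_n)) · Vᵀ; in particular, the columns of V are eigenvectors of (X̄W*)ᵀ(X̄W*).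 -/
open Matrix BigOperators

theorem stmt_6 {m n : ℕ} (hmn : n ≤ m)
    (X U : Matrix (Fin m) (Fin n) ℝ) (V : Matrix (Fin n) (Fin n) ℝ)
    (σ lam : Fin n → ℝ)
    (hU : Uᵀ * U = 1) (hV : Vᵀ * V = 1)
    (hσord : ∀ i j : Fin n, i ≤ j → σ j ≤ σ i) (hσnn : ∀ i, 0 ≤ σ i)
    (hX : X = U * Matrix.diagonal σ * Vᵀ)
    (hlamnn : ∀ i, 0 ≤ lam i) (hpos : ∀ i, 0 < σ i ^ 2 + lam i)
    (Γ : Matrix (Fin n) (Fin n) ℝ)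
    (hΓ : Γᵀ * Γ = V * Matrix.diagonal lam * Vᵀ)
    (Xbar : Matrix (Fin m ⊕ Fin n) (Fin n) ℝ) (hXbar : Xbar = Matrix.fromRows X Γ)
    (Wstar : Matrix (Fin n) (Fin n) ℝ)
    (hWstar : Wstar = (Xᵀ * X + Γᵀ * Γ)⁻¹ * (Xᵀ * X)) :
    (Xbar * Wstar)ᵀ * (Xbar * Wstar) =
      V * Matrix.diagonal (fun i => σ i ^ 4 / (σ i ^ 2 + lam i)) * Vᵀ := by
  have key : ∀ a b : Fin n → ℝ, (V * Matrix.diagonal a * Vᵀ) * (V * Matrix.diagonal b * Vᵀ)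
      = V * Matrix.diagonal (fun i => a i * b i) * Vᵀ := by
    intro a b
    calc (V * Matrix.diagonal a * Vᵀ) * (V * Matrix.diagonal b * Vᵀ)
        = V * Matrix.diagonal a * (Vᵀ * V) * Matrix.diagonal b * Vᵀ := by
          simp only [Matrix.mul_assoc]
      _ = V * (Matrix.diagonal a * Matrix.diagonal b) * Vᵀ := by
          rw [hV, Matrix.mul_one, Matrix.mul_assoc V]
      _ = _ := by rw [Matrix.diagonal_mul_diagonal]
  have hV' : V * Vᵀ = 1 := mul_eq_one_comm.mp hV
  have hXX : Xᵀ * X = V * Matrix.diagonal (fun i => σ i * σ i) * Vᵀ := by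
    rw [hX]
    calc (U * Matrix.diagonal σ * Vᵀ)ᵀ * (U * Matrix.diagonal σ * Vᵀ)
        = V * Matrix.diagonal σ * (Uᵀ * U) * Matrix.diagonal σ * Vᵀ := by
          simp only [Matrix.transpose_mul, Matrix.transpose_transpose,
            Matrix.diagonal_transpose, Matrix.mul_assoc]
      _ = V * (Matrix.diagonal σ * Matrix.diagonal σ) * Vᵀ := by
          rw [hU, Matrix.mul_one, Matrix.mul_assoc V]
      _ = _ := by rw [Matrix.diagonal_mul_diagonal]
  have hG : Xᵀ * X + Γᵀ * Γ = V * Matrix.diagonal (fun i => σ i ^ 2 + lam i) * Vᵀ := by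
    rw [hXX, hΓ, ← Matrix.add_mul, ← Matrix.mul_add, Matrix.diagonal_add]
    simp only [pow_two]
  have hinv : (Xᵀ * X + Γᵀ * Γ)⁻¹ = V * Matrix.diagonal (fun i => (σ i ^ 2 + lam i)⁻¹) * Vᵀ := by
    apply Matrix.inv_eq_right_inv
    rw [hG, key]
    have h1 : (fun i => (σ i ^ 2 + lam i) * (σ i ^ 2 + lam i)⁻¹) = fun _ => (1 : ℝ) := by
      funext i
      exact mul_inv_cancel₀ (hpos i).ne'
    rw [h1, Matrix.diagonal_one, Matrix.mul_one, hV']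
  have hB : Xbarᵀ * Xbar = Xᵀ * X + Γᵀ * Γ := by
    rw [hXbar, Matrix.transpose_fromRows, Matrix.fromCols_mul_fromRows]
  have hW : Wstar = V * Matrix.diagonal (fun i => (σ i ^ 2 + lam i)⁻¹ * (σ i * σ i)) * Vᵀ := by
    rw [hWstar, hinv, hXX, key]
  have hWt : Wstarᵀ = Wstar := by
    rw [hW]
    simp only [Matrix.transpose_mul, Matrix.transpose_transpose,
      Matrix.diagonal_transpose, Matrix.mul_assoc]
  have hassoc : (Xbar * Wstar)ᵀ * (Xbar * Wstar) = Wstarᵀ * (Xbarᵀ * Xbar) * Wstar := by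
    simp only [Matrix.transpose_mul, Matrix.mul_assoc]
  rw [hassoc, hWt, hB, hG, hW, key, key]
  congr 3
  funext i
  have := (hpos i).ne'
  field_simp
end

section
/- Let X be a real m×n matrix (m ≥ n) with singular value decomposition X = UΣVᵀ, where U is m×n with orthonormal columns, V is n×n orthogonal, and Σ = diag(σ₁,…,σ_n) with σ₁ ≥ … ≥ σ_n ≥ 0. Let Λ = diag(λ₁,…,λ_n) with λ_i ≥ 0 and σ_i² + λ_i > 0, let Γ satisfy ΓᵀΓ = VΛVᵀ, let X̄ stack X on top of Γ, and let W* = (XᵀX + ΓᵀΓ)⁻¹XᵀX. Fix 1 ≤ k < n and assume σ_i⁴/(σ_i²+λ_i) ≥ σ_{i+1}⁴/(σ_{i+1}²+λ_{i+1}) for all i, with strict inequality at i = k. Then for every singular value decomposition X̄W* = PΣ'Qᵀ with singular values in non-increasing order, the projection onto the top-k right singular subspace satisfies Q_k Q_kᵀ = V_k V_kᵀ, where Q_k and V_k are the first k columns of Q and V respectively (Proposition: Q_k = V_k up to orthogonal change of basis). -/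
open Matrix BigOperators

lemma conj_mul_aux {n : ℕ} (V : Matrix (Fin n) (Fin n) ℝ) (hV : Vᵀ * V = 1) (a b : Fin n → ℝ) :
    (V * diagonal a * Vᵀ) * (V * diagonal b * Vᵀ) = V * diagonal (fun i => a i * b i) * Vᵀ := by
  calc _ = V * diagonal a * (Vᵀ * V) * diagonal b * Vᵀ := by simp only [Matrix.mul_assoc]
    _ = _ := by rw [hV, Matrix.mul_one, Matrix.mul_assoc V, diagonal_mul_diagonal]

lemma conj_fun_aux {n : ℕ} (Q V : Matrix (Fin n) (Fin n) ℝ) (hQ : Qᵀ * Q = 1) (hV : Vᵀ * V = 1)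
    (e d : Fin n → ℝ) (f : ℝ → ℝ)
    (h : Q * diagonal e * Qᵀ = V * diagonal d * Vᵀ) :
    Q * diagonal (fun i => f (e i)) * Qᵀ = V * diagonal (fun i => f (d i)) * Vᵀ := by
  have hQ' : Q * Qᵀ = 1 := mul_eq_one_comm.mp hQ
  have hV' : V * Vᵀ = 1 := mul_eq_one_comm.mp hV
  have h1 : diagonal e * (Qᵀ * V) = (Qᵀ * V) * diagonal d := by
    calc diagonal e * (Qᵀ * V) = (Qᵀ * Q) * diagonal e * Qᵀ * V := by
          rw [hQ, Matrix.one_mul, Matrix.mul_assoc]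
      _ = Qᵀ * (Q * diagonal e * Qᵀ) * V := by simp only [Matrix.mul_assoc]
      _ = Qᵀ * V * diagonal d * (Vᵀ * V) := by rw [h]; simp only [Matrix.mul_assoc]
      _ = _ := by rw [hV, Matrix.mul_one]
  have h2 : diagonal (fun i => f (e i)) * (Qᵀ * V) = (Qᵀ * V) * diagonal (fun i => f (d i)) := by
    ext i j
    have h3 := congrFun (congrFun h1 i) j
    rw [diagonal_mul, mul_diagonal] at h3 ⊢
    by_cases hr : (Qᵀ * V) i j = 0
    · simp [hr]
    · have : e i = d j := by
        apply mul_right_cancel₀ hr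
        rw [h3, mul_comm]
      rw [this, mul_comm]
  calc _ = Q * (diagonal (fun i => f (e i)) * (Qᵀ * (V * Vᵀ))) := by
        rw [hV', Matrix.mul_one, Matrix.mul_assoc]
    _ = Q * (diagonal (fun i => f (e i)) * (Qᵀ * V)) * Vᵀ := by simp only [Matrix.mul_assoc]
    _ = (Q * Qᵀ) * V * diagonal (fun i => f (d i)) * Vᵀ := by
        rw [h2]; simp only [Matrix.mul_assoc]
    _ = _ := by rw [hQ', Matrix.one_mul]

lemma trace_conj_aux {n : ℕ} (V : Matrix (Fin n) (Fin n) ℝ) (hV : Vᵀ * V = 1) (a : Fin n → ℝ) :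
    (V * diagonal a * Vᵀ).trace = ∑ i, a i := by
  rw [Matrix.trace_mul_comm, ← Matrix.mul_assoc, hV, Matrix.one_mul, trace_diagonal]

lemma submatrix_aux {n k : ℕ} (hk : k ≤ n) (V : Matrix (Fin n) (Fin n) ℝ) :
    (V.submatrix id (Fin.castLE hk)) * (V.submatrix id (Fin.castLE hk))ᵀ =
      V * diagonal (fun i : Fin n => if (i : ℕ) < k then (1 : ℝ) else 0) * Vᵀ := by
  ext a b
  obtain ⟨l, rfl⟩ := Nat.exists_eq_add_of_le hk
  rw [Matrix.mul_apply, Matrix.mul_apply, Fin.sum_univ_add]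
  have h2 : ∑ i : Fin l, (V * diagonal (fun i : Fin (k + l) => if (i : ℕ) < k then (1 : ℝ) else 0))
      a (Fin.natAdd k i) * Vᵀ (Fin.natAdd k i) b = 0 := by
    apply Finset.sum_eq_zero
    intro i _
    rw [mul_diagonal]
    simp
  rw [h2, add_zero]
  apply Finset.sum_congr rfl
  intro i _
  rw [mul_diagonal]
  have hi : ((Fin.castAdd l i : Fin (k + l)) : ℕ) < k := i.2
  rw [if_pos hi, mul_one]
  rfl

lemma lower_aux {n k : ℕ} (hk : k ≤ n) (e : Fin n → ℝ) (t : ℝ)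
    (he : ∀ i j : Fin n, i ≤ j → e j ≤ e i)
    (hc : (Finset.univ.filter (fun i => t < e i)).card = k) (i : Fin n) :
    t < e i ↔ (i : ℕ) < k := by
  constructor
  · intro h
    have : Finset.Iic i ⊆ Finset.univ.filter (fun i => t < e i) := by
      intro j hj
      simp only [Finset.mem_Iic] at hj
      simpa using lt_of_lt_of_le h (he j i hj)
    have := Finset.card_le_card this
    rw [Fin.card_Iic, hc] at this
    omega
  · intro h
    by_contra hn
    have : Finset.univ.filter (fun i => t < e i) ⊆ Finset.Iio i := by
      intro j hj
      simp only [Finset.mem_filter, Finset.mem_univ, true_and] at hj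
      rw [Finset.mem_Iio]
      by_contra hij
      exact hn (lt_of_lt_of_le hj (he i j (not_lt.mp hij)))
    have := Finset.card_le_card this
    rw [Fin.card_Iio, hc] at this
    omega

theorem stmt_7 {m n : ℕ} (hmn : n ≤ m)
    (X U : Matrix (Fin m) (Fin n) ℝ) (V : Matrix (Fin n) (Fin n) ℝ)
    (σ lam : Fin n → ℝ)
    (hU : Uᵀ * U = 1) (hV : Vᵀ * V = 1)
    (hσord : ∀ i j : Fin n, i ≤ j → σ j ≤ σ i) (hσnn : ∀ i, 0 ≤ σ i)
    (hX : X = U * Matrix.diagonal σ * Vᵀ)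
    (hlamnn : ∀ i, 0 ≤ lam i) (hpos : ∀ i, 0 < σ i ^ 2 + lam i)
    (Γ : Matrix (Fin n) (Fin n) ℝ)
    (hΓ : Γᵀ * Γ = V * Matrix.diagonal lam * Vᵀ)
    (Xbar : Matrix (Fin m ⊕ Fin n) (Fin n) ℝ) (hXbar : Xbar = Matrix.fromRows X Γ)
    (Wstar : Matrix (Fin n) (Fin n) ℝ)
    (hWstar : Wstar = (Xᵀ * X + Γᵀ * Γ)⁻¹ * (Xᵀ * X))
    (k : ℕ) (hk1 : 1 ≤ k) (hklt : k < n)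
    (hord : ∀ i j : Fin n, i ≤ j →
      σ j ^ 4 / (σ j ^ 2 + lam j) ≤ σ i ^ 4 / (σ i ^ 2 + lam i))
    (hstrict : σ (⟨k, by omega⟩ : Fin n) ^ 4 / (σ (⟨k, by omega⟩ : Fin n) ^ 2 + lam ⟨k, by omega⟩)
      < σ (⟨k - 1, by omega⟩ : Fin n) ^ 4 /
          (σ (⟨k - 1, by omega⟩ : Fin n) ^ 2 + lam ⟨k - 1, by omega⟩)) :
    ∀ (P : Matrix (Fin m ⊕ Fin n) (Fin n) ℝ) (Q : Matrix (Fin n) (Fin n) ℝ) (σ' : Fin n → ℝ),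
      Pᵀ * P = 1 → Qᵀ * Q = 1 → (∀ i, 0 ≤ σ' i) →
      (∀ i j : Fin n, i ≤ j → σ' j ≤ σ' i) →
      Xbar * Wstar = P * Matrix.diagonal σ' * Qᵀ →
      (Q.submatrix id (Fin.castLE hklt.le)) * (Q.submatrix id (Fin.castLE hklt.le))ᵀ =
        (V.submatrix id (Fin.castLE hklt.le)) * (V.submatrix id (Fin.castLE hklt.le))ᵀ := by
  intro P Q σ' hP hQ hσ' hσ'ord hsvd
  have hV' : V * Vᵀ = 1 := mul_eq_one_comm.mp hV
  have hXX : Xᵀ * X = V * diagonal (fun i => σ i * σ i) * Vᵀ := by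
    rw [hX]
    simp only [transpose_mul, transpose_transpose, diagonal_transpose]
    calc _ = V * diagonal σ * (Uᵀ * U) * diagonal σ * Vᵀ := by simp only [Matrix.mul_assoc]
      _ = _ := by rw [hU, Matrix.mul_one, Matrix.mul_assoc V, diagonal_mul_diagonal]
  have hA : Xᵀ * X + Γᵀ * Γ = V * diagonal (fun i => σ i ^ 2 + lam i) * Vᵀ := by
    rw [hXX, hΓ, ← Matrix.add_mul, ← Matrix.mul_add, diagonal_add]
    simp only [pow_two]
  have hAinv : (Xᵀ * X + Γᵀ * Γ)⁻¹ = V * diagonal (fun i => (σ i ^ 2 + lam i)⁻¹) * Vᵀ := by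
    apply Matrix.inv_eq_right_inv
    rw [hA, conj_mul_aux V hV]
    have : (fun i => (σ i ^ 2 + lam i) * (σ i ^ 2 + lam i)⁻¹) = fun _ => (1 : ℝ) := by
      funext i
      exact mul_inv_cancel₀ (hpos i).ne'
    rw [this, diagonal_one, Matrix.mul_one, hV']
  have hW : Wstar = V * diagonal (fun i => (σ i ^ 2 + lam i)⁻¹ * (σ i * σ i)) * Vᵀ := by
    rw [hWstar, hAinv, hXX, conj_mul_aux V hV]
  have hXbXb : Xbarᵀ * Xbar = V * diagonal (fun i => σ i ^ 2 + lam i) * Vᵀ := by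
    rw [← hA, hXbar, transpose_fromRows, fromCols_mul_fromRows]
  have hWt : Wstarᵀ = Wstar := by
    rw [hW]
    simp only [transpose_mul, transpose_transpose, diagonal_transpose, Matrix.mul_assoc]
  have hM1 : (Xbar * Wstar)ᵀ * (Xbar * Wstar) =
      V * diagonal (fun i => σ i ^ 4 / (σ i ^ 2 + lam i)) * Vᵀ := by
    rw [transpose_mul, hWt, Matrix.mul_assoc, ← Matrix.mul_assoc Xbarᵀ, hXbXb, hW,
      conj_mul_aux V hV, conj_mul_aux V hV]
    congr 3
    funext i
    have := (hpos i).ne'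
    field_simp
  have hM2 : (Xbar * Wstar)ᵀ * (Xbar * Wstar) = Q * diagonal (fun i => σ' i * σ' i) * Qᵀ := by
    rw [hsvd]
    simp only [transpose_mul, transpose_transpose, diagonal_transpose]
    calc _ = Q * diagonal σ' * (Pᵀ * P) * diagonal σ' * Qᵀ := by simp only [Matrix.mul_assoc]
      _ = _ := by rw [hP, Matrix.mul_one, Matrix.mul_assoc Q, diagonal_mul_diagonal]
  set d : Fin n → ℝ := fun i => σ i ^ 4 / (σ i ^ 2 + lam i) with hd
  set t : ℝ := d ⟨k, hklt⟩ with ht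
  have hdk : ∀ i : Fin n, t < d i ↔ (i : ℕ) < k := by
    intro i
    constructor
    · intro h
      by_contra hn
      exact absurd (hord ⟨k, hklt⟩ i (by rw [Fin.le_def]; simpa using hn)) (not_le.mpr h)
    · intro h
      exact lt_of_lt_of_le hstrict (hord i ⟨k - 1, by omega⟩ (by rw [Fin.le_def]; simp; omega))
  have key := conj_fun_aux Q V hQ hV (fun i => σ' i * σ' i) d (fun x => if t < x then 1 else 0)
    (hM2.symm.trans hM1)
  have hcard : (Finset.univ.filter (fun i => t < σ' i * σ' i)).card = k := by
    have h := congrArg Matrix.trace key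
    rw [trace_conj_aux Q hQ, trace_conj_aux V hV, Finset.sum_boole, Finset.sum_boole] at h
    have h' := Nat.cast_injective h
    rw [h']
    simp only [hdk]
    rw [Fin.card_filter_val_lt]
    omega
  have hek := lower_aux hklt.le (fun i => σ' i * σ' i) t
    (fun i j hij => mul_self_le_mul_self (hσ' j) (hσ'ord i j hij)) hcard
  simp only [hdk, hek] at key
  rw [submatrix_aux, submatrix_aux, key]
end

section
/- Let X be a real m×n matrix (m ≥ n) with singular value decomposition X = UΣVᵀ, where U is m×n with orthonormal columns, V is n×n orthogonal, and Σ = diag(σ₁,…,σ_n) with σ₁ ≥ … ≥ σ_n ≥ 0. Let λ > 0 and fix 1 ≤ k ≤ n. Then Ŵ = V_k · diag(σ₁²/(σ₁²+λ), …, σ_k²/(σ_k²+λ)) · V_kᵀ minimizes ‖X − XW‖_F² + λ‖W‖_F² over all real n×n matrices W with rank(W) ≤ k, where V_k denotes the first k columns of V. -/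
open Matrix BigOperators

theorem frobSq_mul_left {m n p : Type*} [Fintype m] [Fintype n] [Fintype p] [DecidableEq n]
    (U : Matrix m n ℝ) (hU : Uᵀ * U = 1) (A : Matrix n p ℝ) :
    frobSq (U * A) = frobSq A := by
  rw [frobSq_eq_trace, frobSq_eq_trace, Matrix.transpose_mul, Matrix.mul_assoc,
    ← Matrix.mul_assoc Uᵀ, hU, Matrix.one_mul]

theorem frobSq_mul_right {m n p : Type*} [Fintype m] [Fintype n] [Fintype p] [DecidableEq n]
    (V : Matrix p n ℝ) (hV : Vᵀ * V = 1) (A : Matrix m n ℝ) :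
    frobSq (A * Vᵀ) = frobSq A := by
  rw [frobSq_eq_trace, frobSq_eq_trace, Matrix.transpose_mul, Matrix.transpose_transpose,
    Matrix.trace_mul_comm, Matrix.mul_assoc, ← Matrix.mul_assoc Vᵀ, hV, Matrix.one_mul,
    Matrix.trace_mul_comm]

theorem obj_eq {m n : ℕ} (X U : Matrix (Fin m) (Fin n) ℝ) (V : Matrix (Fin n) (Fin n) ℝ)
    (σ : Fin n → ℝ) (hU : Uᵀ * U = 1) (hV : Vᵀ * V = 1)
    (hX : X = U * Matrix.diagonal σ * Vᵀ) (lam : ℝ) (Y : Matrix (Fin n) (Fin n) ℝ) :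
    frobSq (X - X * (V * Y * Vᵀ)) + lam * frobSq (V * Y * Vᵀ)
      = ∑ i, (σ i ^ 2 - 2 * σ i ^ 2 * Y i i + (σ i ^ 2 + lam) * ∑ j, Y i j ^ 2) := by
  have h1 : X - X * (V * Y * Vᵀ) = U * (Matrix.diagonal σ * (1 - Y)) * Vᵀ := by
    have : X * (V * Y * Vᵀ) = U * (Matrix.diagonal σ * Y) * Vᵀ := by
      rw [hX]
      calc _ = U * Matrix.diagonal σ * (Vᵀ * V) * Y * Vᵀ := by simp only [Matrix.mul_assoc]
        _ = _ := by rw [hV, Matrix.mul_one]; simp only [Matrix.mul_assoc]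
    rw [this, hX, Matrix.mul_sub, Matrix.mul_sub, Matrix.sub_mul, Matrix.mul_one]
  rw [h1, frobSq_mul_right V hV, frobSq_mul_right V hV, frobSq_mul_left U hU,
    frobSq_mul_left V hV]
  unfold frobSq
  rw [Finset.mul_sum, ← Finset.sum_add_distrib]
  refine Finset.sum_congr rfl fun i _ => ?_
  have : ∀ j, (Matrix.diagonal σ * (1 - Y)) i j ^ 2
      = (if i = j then σ i ^ 2 - 2 * σ i ^ 2 * Y i j else 0) + σ i ^ 2 * Y i j ^ 2 := by
    intro j
    rw [Matrix.diagonal_mul, Matrix.sub_apply, Matrix.one_apply]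
    split_ifs <;> ring
  simp only [this, Finset.sum_add_distrib, Finset.sum_ite_eq, Finset.mem_univ, if_true,
    ← Finset.mul_sum]
  ring

theorem exists_proj {n : ℕ} (Y : Matrix (Fin n) (Fin n) ℝ) :
    ∃ P : Matrix (Fin n) (Fin n) ℝ, Pᵀ = P ∧ P * P = P ∧ Y * P = Y ∧ P.trace = Y.rank := by
  classical
  let S : Submodule ℝ (EuclideanSpace ℝ (Fin n)) := LinearMap.range (Matrix.toEuclideanLin Yᵀ)
  have hS : Module.finrank ℝ S = Y.rank := by
    rw [← Matrix.rank_transpose Y, Matrix.rank_eq_finrank_range_toLin Yᵀ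
      (EuclideanSpace.basisFun (Fin n) ℝ).toBasis (EuclideanSpace.basisFun (Fin n) ℝ).toBasis]
    rw [← Matrix.toEuclideanLin_eq_toLin_orthonormal]
  let b := stdOrthonormalBasis ℝ S
  let B : Matrix (Fin (Module.finrank ℝ S)) (Fin n) ℝ := fun l i => (b l : EuclideanSpace ℝ (Fin n)) i
  have hB : B * Bᵀ = 1 := by
    ext l l'
    have := orthonormal_iff_ite.mp b.orthonormal l' l
    simp only [Submodule.coe_inner, PiLp.inner_apply] at this
    rw [Matrix.mul_apply, Matrix.one_apply]
    simp only [eq_comm (a := l) (b := l')]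
    rw [← this]
    simp [B, Matrix.transpose_apply, Matrix.transpose]
  refine ⟨Bᵀ * B, by simp, ?_, ?_, ?_⟩
  · rw [Matrix.mul_assoc, ← Matrix.mul_assoc B, hB, Matrix.one_mul]
  · ext i j
    let y : S := ⟨WithLp.toLp 2 (Y i), ⟨WithLp.toLp 2 (Pi.single i 1), by
      ext j; simp [Matrix.toEuclideanLin]⟩⟩
    have h := congrArg (fun z : S => (z : EuclideanSpace ℝ (Fin n)) j) (b.sum_repr' y)
    simp only [Submodule.coe_sum, Submodule.coe_smul, Submodule.coe_inner, PiLp.inner_apply] at h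
    rw [← Matrix.mul_assoc, Matrix.mul_apply]
    simp only [Matrix.mul_apply, Matrix.transpose_apply]
    simpa [y, B] using h
  · rw [Matrix.trace_mul_comm, hB, Matrix.trace_one, Fintype.card_fin, hS]

theorem g_mono {a b l : ℝ} (hl : 0 < l) (ha : 0 ≤ a) (hab : a ≤ b) :
    a ^ 2 / (a + l) ≤ b ^ 2 / (b + l) := by
  rw [div_le_div_iff₀ (by linarith) (by linarith)]
  nlinarith [mul_nonneg (mul_nonneg ha (ha.trans hab)) (sub_nonneg.2 hab),
    mul_nonneg hl.le (mul_nonneg (sub_nonneg.2 hab) (add_nonneg ha (ha.trans hab)))]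

theorem stmt_9 {m n : ℕ} (hmn : n ≤ m)
    (X U : Matrix (Fin m) (Fin n) ℝ) (V : Matrix (Fin n) (Fin n) ℝ)
    (σ : Fin n → ℝ)
    (hU : Uᵀ * U = 1) (hV : Vᵀ * V = 1)
    (hσord : ∀ i j : Fin n, i ≤ j → σ j ≤ σ i) (hσnn : ∀ i, 0 ≤ σ i)
    (hX : X = U * Matrix.diagonal σ * Vᵀ)
    (lam : ℝ) (hlam : 0 < lam)
    (k : ℕ) (hk1 : 1 ≤ k) (hk : k ≤ n) :
    let Vk : Matrix (Fin n) (Fin k) ℝ := V.submatrix id (Fin.castLE hk)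
    let What : Matrix (Fin n) (Fin n) ℝ :=
      Vk * Matrix.diagonal (fun i : Fin k =>
        σ (Fin.castLE hk i) ^ 2 / (σ (Fin.castLE hk i) ^ 2 + lam)) * Vkᵀ
    What.rank ≤ k ∧
    ∀ W : Matrix (Fin n) (Fin n) ℝ, W.rank ≤ k →
      frobSq (X - X * What) + lam * frobSq What ≤ frobSq (X - X * W) + lam * frobSq W := by
  intro Vk What
  refine ⟨?_, ?_⟩
  · refine (Matrix.rank_mul_le_right _ _).trans ?_
    exact (Matrix.rank_le_height _)
  intro W hW
  have hV' : V * Vᵀ = 1 := mul_eq_one_comm.mp hV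
  -- sums over the first k indices
  have hsum : ∀ f : Fin n → ℝ, ∑ i : Fin k, f (Fin.castLE hk i)
      = ∑ i : Fin n, if (i : ℕ) < k then f i else 0 := by
    intro f
    rw [← Finset.sum_filter]
    refine Finset.sum_bij (fun i _ => Fin.castLE hk i) ?_ ?_ ?_ ?_
    · intro i _; simp
    · intro i _ j _ h; exact Fin.castLE_injective hk h
    · intro i hi
      exact ⟨⟨i, (Finset.mem_filter.mp hi).2⟩, Finset.mem_univ _, rfl⟩
    · intro i _; rfl
  have hd : ∀ i, 0 < σ i ^ 2 + lam := fun i => by positivity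
  let c : Fin n → ℝ := fun i => if (i : ℕ) < k then σ i ^ 2 / (σ i ^ 2 + lam) else 0
  have hWhat : What = V * Matrix.diagonal c * Vᵀ := by
    ext i j
    simp only [What, Vk]
    rw [Matrix.mul_apply, Matrix.mul_apply]
    simp only [Matrix.mul_diagonal, Matrix.transpose_apply, Matrix.submatrix_apply, id]
    rw [hsum (fun l => V i l * (σ l ^ 2 / (σ l ^ 2 + lam)) * V j l)]
    refine Finset.sum_congr rfl fun l _ => ?_
    simp only [c]
    split_ifs <;> simp
  let Y := Vᵀ * W * V
  have hWY : W = V * Y * Vᵀ := by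
    calc W = (V * Vᵀ) * W * (V * Vᵀ) := by rw [hV']; simp
      _ = _ := by simp only [Y, Matrix.mul_assoc]
  have hYr : Y.rank ≤ k :=
    (Matrix.rank_mul_le_left _ _).trans ((Matrix.rank_mul_le_right _ _).trans hW)
  rw [hWhat, hWY, obj_eq X U V σ hU hV hX, obj_eq X U V σ hU hV hX]
  obtain ⟨P, hPt, hPP, hYP, hPtr⟩ := exists_proj Y
  have hPs : ∀ i j, P i j = P j i := fun i j => by
    conv_lhs => rw [← hPt]
    rfl
  have hPd : ∀ i, ∑ j, P i j ^ 2 = P i i := fun i => by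
    conv_rhs => rw [← hPP, Matrix.mul_apply]
    exact Finset.sum_congr rfl fun j _ => by rw [hPs j i]; ring
  have hP0 : ∀ i, 0 ≤ P i i := fun i => by rw [← hPd]; positivity
  have hP1 : ∀ i, P i i ≤ 1 := fun i => by
    have h := Finset.single_le_sum (f := fun j => P i j ^ 2) (fun j _ => sq_nonneg _)
      (Finset.mem_univ i)
    simp only [hPd] at h
    nlinarith [hP0 i]
  have hPsum : ∑ i, P i i ≤ k := by
    have : ∑ i, P i i = Y.rank := hPtr
    rw [this]; exact_mod_cast hYr
  have hYi : ∀ i, ∑ j, Y i j * P i j = Y i i := fun i => by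
    conv_rhs => rw [← hYP, Matrix.mul_apply]
    exact Finset.sum_congr rfl fun j _ => by rw [hPs j i]
  let g : Fin n → ℝ := fun i => (σ i ^ 2) ^ 2 / (σ i ^ 2 + lam)
  have hlow : ∀ i, σ i ^ 2 - g i * P i i ≤
      σ i ^ 2 - 2 * σ i ^ 2 * Y i i + (σ i ^ 2 + lam) * ∑ j, Y i j ^ 2 := by
    intro i
    have h0 : 0 ≤ (σ i ^ 2 + lam) *
        ∑ j, (Y i j - σ i ^ 2 / (σ i ^ 2 + lam) * P i j) ^ 2 :=
      mul_nonneg (hd i).le (Finset.sum_nonneg fun j _ => sq_nonneg _)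
    have h1 : ∑ j, (Y i j - σ i ^ 2 / (σ i ^ 2 + lam) * P i j) ^ 2
        = ∑ j, Y i j ^ 2 - 2 * (σ i ^ 2 / (σ i ^ 2 + lam)) * Y i i
          + (σ i ^ 2 / (σ i ^ 2 + lam)) ^ 2 * P i i := by
      rw [← hYi i, ← hPd i, Finset.mul_sum, Finset.mul_sum, ← Finset.sum_sub_distrib,
        ← Finset.sum_add_distrib]
      exact Finset.sum_congr rfl fun j _ => by ring
    rw [h1] at h0
    have hne := (hd i).ne'
    have h2 : (σ i ^ 2 + lam) * (∑ j, Y i j ^ 2 - 2 * (σ i ^ 2 / (σ i ^ 2 + lam)) * Y i i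
          + (σ i ^ 2 / (σ i ^ 2 + lam)) ^ 2 * P i i)
        = (σ i ^ 2 + lam) * ∑ j, Y i j ^ 2 - 2 * σ i ^ 2 * Y i i + g i * P i i := by
      simp only [g]
      field_simp
    rw [h2] at h0
    linarith
  have hup : ∀ i, σ i ^ 2 - 2 * σ i ^ 2 * Matrix.diagonal c i i
      + (σ i ^ 2 + lam) * ∑ j, Matrix.diagonal c i j ^ 2
      = σ i ^ 2 - (if (i : ℕ) < k then g i else 0) := by
    intro i
    have h1 : ∑ j, Matrix.diagonal c i j ^ 2 = c i ^ 2 := by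
      rw [Finset.sum_eq_single i]
      · simp
      · intro j _ hj; simp [Matrix.diagonal_apply_ne _ hj.symm]
      · simp
    rw [h1, Matrix.diagonal_apply_eq]
    have hne := (hd i).ne'
    simp only [c, g]
    split_ifs
    · field_simp
      ring
    · simp
  rw [Finset.sum_congr rfl fun i _ => hup i]
  refine le_trans ?_ (Finset.sum_le_sum fun i _ => hlow i)
  rw [Finset.sum_sub_distrib, Finset.sum_sub_distrib]
  refine sub_le_sub_left ?_ _
  have hganti : ∀ i j : Fin n, i ≤ j → g j ≤ g i := fun i j hij =>
    g_mono hlam (sq_nonneg _) (pow_le_pow_left₀ (hσnn j) (hσord i j hij) 2)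
  let i0 : Fin n := ⟨k - 1, by omega⟩
  have hθ : 0 ≤ g i0 := by
    have := hd i0
    positivity
  have hpt : ∀ i : Fin n, g i * P i i ≤ (if (i : ℕ) < k then g i else 0)
      + g i0 * (P i i - (if (i : ℕ) < k then 1 else 0)) := by
    intro i
    split_ifs with h
    · have : g i0 ≤ g i := hganti i i0 (by rw [Fin.le_def]; simp only [i0]; omega)
      nlinarith [hP1 i]
    · have : g i ≤ g i0 := hganti i0 i (by rw [Fin.le_def]; simp only [i0]; omega)
      nlinarith [hP0 i]
  refine (Finset.sum_le_sum fun i _ => hpt i).trans ?_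
  rw [Finset.sum_add_distrib, ← Finset.mul_sum, Finset.sum_sub_distrib, ← hsum (fun _ => 1)]
  have : g i0 * (∑ i, P i i - ∑ _i : Fin k, (1 : ℝ)) ≤ 0 := by
    refine mul_nonpos_of_nonneg_of_nonpos hθ ?_
    simp only [Finset.sum_const, Finset.card_univ, Fintype.card_fin, nsmul_eq_mul, mul_one]
    linarith
  linarith
end

section
/- Let X be a real m×n matrix (m ≥ n) with singular value decomposition X = UΣVᵀ, where U is m×n with orthonormal columns, V is n×n orthogonal, and Σ = diag(σ₁,…,σ_n) with σ₁ ≥ … ≥ σ_n > 0. Fix 1 ≤ k ≤ n and λ' ∈ ℝ, and let M = U_k · diag(σ₁−λ', …, σ_k−λ') · V_kᵀ be the matrix-factorization prediction matrix. Then the matrix factorization model can be represented as a linear autoencoder: the matrix Ŵ = V_k · diag(1−λ'/σ₁, …, 1−λ'/σ_k) · V_kᵀ satisfies XŴ = M, and moreover Ŵ = X⁺M where X⁺ = VΣ⁻¹Uᵀ is the Moore–Penrose pseudoinverse of X. -/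
open Matrix BigOperators

theorem aux_mul {a b p n k : ℕ} (c : Fin k → Fin n)
    (A : Matrix (Fin a) (Fin n) ℝ) (B : Matrix (Fin b) (Fin n) ℝ) (C : Matrix (Fin k) (Fin p) ℝ)
    (d : Fin n → ℝ) (e : Fin k → ℝ) (hB : Bᵀ * B = 1) :
    A * Matrix.diagonal d * Bᵀ * (B.submatrix id c * Matrix.diagonal e * C)
      = A.submatrix id c * Matrix.diagonal (fun i => d (c i) * e i) * C := by
  have h1 : Bᵀ * B.submatrix id c = (1 : Matrix (Fin n) (Fin n) ℝ).submatrix id c := by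
    rw [← hB]; rfl
  have h2 : A * Matrix.diagonal d * (1 : Matrix (Fin n) (Fin n) ℝ).submatrix id c
      = A.submatrix id c * Matrix.diagonal (fun i => d (c i)) := by
    have : A * Matrix.diagonal d * (1 : Matrix (Fin n) (Fin n) ℝ).submatrix id c
      = (A * Matrix.diagonal d * (1 : Matrix (Fin n) (Fin n) ℝ)).submatrix id c := rfl
    rw [this, Matrix.mul_one]
    ext i j
    simp [Matrix.mul_diagonal]
  calc _ = A * Matrix.diagonal d * (Bᵀ * B.submatrix id c) * Matrix.diagonal e * C := by
        simp only [Matrix.mul_assoc]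
    _ = _ := by
        rw [h1, h2, Matrix.mul_assoc (A.submatrix id c), Matrix.diagonal_mul_diagonal]

theorem stmt_12 {m n : ℕ} (hmn : n ≤ m)
    (X U : Matrix (Fin m) (Fin n) ℝ) (V : Matrix (Fin n) (Fin n) ℝ)
    (σ : Fin n → ℝ)
    (hU : Uᵀ * U = 1) (hV : Vᵀ * V = 1)
    (hσord : ∀ i j : Fin n, i ≤ j → σ j ≤ σ i) (hσpos : ∀ i, 0 < σ i)
    (hX : X = U * Matrix.diagonal σ * Vᵀ)
    (k : ℕ) (hk1 : 1 ≤ k) (hk : k ≤ n) (lam' : ℝ) :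
    let Uk : Matrix (Fin m) (Fin k) ℝ := U.submatrix id (Fin.castLE hk)
    let Vk : Matrix (Fin n) (Fin k) ℝ := V.submatrix id (Fin.castLE hk)
    let M : Matrix (Fin m) (Fin n) ℝ :=
      Uk * Matrix.diagonal (fun i : Fin k => σ (Fin.castLE hk i) - lam') * Vkᵀ
    let What : Matrix (Fin n) (Fin n) ℝ :=
      Vk * Matrix.diagonal (fun i : Fin k => 1 - lam' / σ (Fin.castLE hk i)) * Vkᵀ
    let Xpinv : Matrix (Fin n) (Fin m) ℝ := V * Matrix.diagonal (fun i => (σ i)⁻¹) * Uᵀ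
    X * What = M ∧ What = Xpinv * M := by
  intro Uk Vk M What Xpinv
  constructor
  · simp only [hX, What, M, Vk, Uk]
    rw [aux_mul (Fin.castLE hk) U V _ σ _ hV]
    congr 3
    funext i
    have := (hσpos (Fin.castLE hk i)).ne'
    field_simp
  · simp only [Xpinv, What, M, Vk, Uk]
    rw [aux_mul (Fin.castLE hk) V U _ _ _ hU]
    congr 3
    funext i
    have := (hσpos (Fin.castLE hk i)).ne'
    field_simp
end
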